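/- arXiv:2408.16799 — 2 statements merged into one kernel-verified Lean document; each statement's English description precedes it below -/
import Mathlib

section
/- Assume additionally that there exist constants 0 < c ≤ C < ∞ with c ≤ Z(D,D*) ≤ C for all (D,D*), and let ψ be bounded measurable and K a positive integer. For real n1, n2 define F(n1, n2) = E_D[ ( E_{D*|D}[ ⟨ψ⟩ · Z^{n2} ] / E_{D*|D}[ Z^{n2} ] )^K · ( E_{D*|D}[ Z^{n2} ] )^{n1} ]. Then F(n1, n2) → E_D[ ( E_{D*|D}[ ⟨ψ⟩ ] )^K ] as (n1, n2) → (0, 0). In other words, the analytic continuation to n1, n2 → 0 of the replicated-system correlation among K replicas with pairwise distinct first replica indices encodes the quantity E_D[ E_{D*|D}[⟨ψ⟩]^K ]. -/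
open MeasureTheory ProbabilityTheory Filter

lemma abs_log_le_log_of_inv_le_of_le {M x : ℝ} (hM : 1 ≤ M) (h1 : M⁻¹ ≤ x) (h2 : x ≤ M) :
    |Real.log x| ≤ Real.log M := by
  have hM0 : 0 < M := by linarith
  have hx : 0 < x := lt_of_lt_of_le (inv_pos.2 hM0) h1
  rw [abs_le, ← Real.log_inv]
  exact ⟨Real.log_le_log (inv_pos.2 hM0) h1, Real.log_le_log hx h2⟩

/-- Real powers with exponent in `[-1, 1]` preserve the interval `[M⁻¹, M]`. -/
lemma rpow_mem_Icc_inv_self {M x t : ℝ} (hM : 1 ≤ M) (hx : x ∈ Set.Icc M⁻¹ M) (ht : |t| ≤ 1) :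
    x ^ t ∈ Set.Icc M⁻¹ M := by
  have hM0 : 0 < M := by linarith
  have hx0 : 0 < x := lt_of_lt_of_le (inv_pos.2 hM0) hx.1
  have h : |Real.log x * t| ≤ Real.log M := by
    rw [abs_mul]
    calc |Real.log x| * |t| ≤ |Real.log x| * 1 := by gcongr
      _ ≤ Real.log M := by
        rw [mul_one]; exact abs_log_le_log_of_inv_le_of_le hM hx.1 hx.2
  rw [abs_le] at h
  rw [Real.rpow_def_of_pos hx0]
  constructor
  · calc M⁻¹ = Real.exp (-Real.log M) := by rw [Real.exp_neg, Real.exp_log hM0]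
      _ ≤ _ := Real.exp_le_exp.2 h.1
  · calc _ ≤ Real.exp (Real.log M) := Real.exp_le_exp.2 h.2
      _ = M := Real.exp_log hM0

lemma integral_mem_Icc_of_forall_mem {Ω : Type*} [MeasurableSpace Ω] {μ : Measure Ω}
    [IsProbabilityMeasure μ] {f : Ω → ℝ} {a b : ℝ} (hf : Integrable f μ)
    (h : ∀ ω, f ω ∈ Set.Icc a b) : ∫ ω, f ω ∂μ ∈ Set.Icc a b := by
  constructor
  · simpa using integral_mono (integrable_const a) hf fun ω => (h ω).1
  · simpa using integral_mono hf (integrable_const b) fun ω => (h ω).2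

lemma integrable_rpow_of_mem_Icc {Ω : Type*} [MeasurableSpace Ω] {μ : Measure Ω}
    [IsProbabilityMeasure μ] {z : Ω → ℝ} (hz : Measurable z) {M t : ℝ} (hM : 1 ≤ M)
    (hzM : ∀ ω, z ω ∈ Set.Icc M⁻¹ M) (ht : |t| ≤ 1) :
    Integrable (fun ω => z ω ^ t) μ := by
  refine Integrable.of_bound (hz.pow_const t).aestronglyMeasurable M (ae_of_all _ fun ω => ?_)
  have h := rpow_mem_Icc_inv_self hM (hzM ω) ht
  have h0 : 0 < M⁻¹ := inv_pos.2 (by linarith)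
  rw [Real.norm_of_nonneg (h0.le.trans h.1)]
  exact h.2

lemma abs_integral_mul_rpow_div_le {Ω : Type*} [MeasurableSpace Ω] {μ : Measure Ω}
    [IsProbabilityMeasure μ] {g z : Ω → ℝ} (hz : Measurable z)
    {B M t : ℝ} (hgB : ∀ ω, |g ω| ≤ B) (hM : 1 ≤ M) (hzM : ∀ ω, z ω ∈ Set.Icc M⁻¹ M)
    (ht : |t| ≤ 1) :
    |(∫ ω, g ω * z ω ^ t ∂μ) / ∫ ω, z ω ^ t ∂μ| ≤ B := by
  have h0 : 0 < M⁻¹ := inv_pos.2 (by linarith)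
  have hi := integrable_rpow_of_mem_Icc (μ := μ) hz hM hzM ht
  have hI := integral_mem_Icc_of_forall_mem hi fun ω => rpow_mem_Icc_inv_self hM (hzM ω) ht
  have hIpos := h0.trans_le hI.1
  rw [abs_div, abs_of_pos hIpos, div_le_iff₀ hIpos, ← integral_const_mul, ← Real.norm_eq_abs]
  refine norm_integral_le_of_norm_le (hi.const_mul B) (ae_of_all _ fun ω => ?_)
  have hp := h0.trans_le (rpow_mem_Icc_inv_self hM (hzM ω) ht).1
  rw [Real.norm_eq_abs, abs_mul, abs_of_pos hp]
  exact mul_le_mul_of_nonneg_right (hgB ω) hp.le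

lemma tendsto_integral_mul_rpow_zero {Ω : Type*} [MeasurableSpace Ω] {μ : Measure Ω}
    [IsProbabilityMeasure μ] {g z : Ω → ℝ} (hg : Measurable g) (hz : Measurable z)
    {B M : ℝ} (hgB : ∀ ω, |g ω| ≤ B) (hM : 1 ≤ M) (hzM : ∀ ω, z ω ∈ Set.Icc M⁻¹ M) :
    Tendsto (fun t : ℝ => ∫ ω, g ω * z ω ^ t ∂μ) (nhds 0) (nhds (∫ ω, g ω ∂μ)) := by
  have h0 : 0 < M⁻¹ := inv_pos.2 (by linarith)
  refine tendsto_integral_filter_of_dominated_convergence (fun _ => B * M)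
    (Eventually.of_forall fun t => (hg.mul (hz.pow_const t)).aestronglyMeasurable) ?_
    (integrable_const _) (ae_of_all _ fun ω => ?_)
  · filter_upwards [Metric.closedBall_mem_nhds (0 : ℝ) one_pos] with t ht
    refine ae_of_all _ fun ω => ?_
    have h := rpow_mem_Icc_inv_self hM (hzM ω) (t := t) (by simpa using ht)
    rw [Real.norm_eq_abs, abs_mul, abs_of_pos (h0.trans_le h.1)]
    exact mul_le_mul (hgB ω) h.2 (h0.le.trans h.1) ((abs_nonneg _).trans (hgB ω))
  · have h : ContinuousAt (fun t : ℝ => z ω ^ t) 0 :=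
      Real.continuousAt_const_rpow (h0.trans_le (hzM ω).1).ne'
    simpa using h.tendsto.const_mul (g ω)

/-- The `(n₁, n₂) → (0, 0)` limit of the replicated average, for an arbitrary bounded observable
`g` and a weight `z` bounded above and away from zero. -/
lemma tendsto_integral_tilted_average_pow_mul_rpow {Ω Ω' : Type*} [MeasurableSpace Ω]
    [MeasurableSpace Ω'] (μ : Measure Ω) [IsProbabilityMeasure μ] (κ : Kernel Ω Ω')
    [IsMarkovKernel κ] {g z : Ω → Ω' → ℝ} (hg : Measurable (Function.uncurry g))
    (hz : Measurable (Function.uncurry z)) {B M : ℝ} (hgB : ∀ x y, |g x y| ≤ B) (hM : 1 ≤ M)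
    (hzM : ∀ x y, z x y ∈ Set.Icc M⁻¹ M) (K : ℕ) :
    Tendsto
      (fun n : ℝ × ℝ =>
        ∫ x, ((∫ y, g x y * z x y ^ n.2 ∂κ x) / (∫ y, z x y ^ n.2 ∂κ x)) ^ K *
          (∫ y, z x y ^ n.2 ∂κ x) ^ n.1 ∂μ)
      (nhds ((0 : ℝ), (0 : ℝ))) (nhds (∫ x, (∫ y, g x y ∂κ x) ^ K ∂μ)) := by
  have h0 : 0 < M⁻¹ := inv_pos.2 (by linarith)
  have hgx (x : Ω) : Measurable (g x) := hg.comp measurable_prodMk_left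
  have hzx (x : Ω) : Measurable (z x) := hz.comp measurable_prodMk_left
  refine tendsto_integral_filter_of_dominated_convergence (fun _ => B ^ K * M)
    (Eventually.of_forall fun n => ?_) ?_ (integrable_const _) (ae_of_all _ fun x => ?_)
  · have hden : Measurable fun x => ∫ y, z x y ^ n.2 ∂κ x :=
      ((hz.pow_const n.2).stronglyMeasurable.integral_kernel_prod_right').measurable
    have hnum : Measurable fun x => ∫ y, g x y * z x y ^ n.2 ∂κ x :=
      ((hg.mul (hz.pow_const n.2)).stronglyMeasurable.integral_kernel_prod_right').measurable
    exact (((hnum.div hden).pow_const K).mul (hden.pow_const n.1)).aestronglyMeasurable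
  · filter_upwards [Metric.closedBall_mem_nhds ((0 : ℝ), (0 : ℝ)) one_pos] with n hn
    rw [Metric.mem_closedBall, Prod.dist_eq, max_le_iff] at hn
    have hn1 : |n.1| ≤ 1 := by simpa using hn.1
    have hn2 : |n.2| ≤ 1 := by simpa using hn.2
    refine ae_of_all _ fun x => ?_
    have hI := integral_mem_Icc_of_forall_mem
      (integrable_rpow_of_mem_Icc (μ := κ x) (hzx x) hM (hzM x) hn2)
      fun y => rpow_mem_Icc_inv_self hM (hzM x y) hn2
    have hp := rpow_mem_Icc_inv_self hM hI hn1
    have hr := abs_integral_mul_rpow_div_le (μ := κ x) (hzx x) (hgB x) hM (hzM x) hn2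
    rw [Real.norm_eq_abs, abs_mul, abs_pow, abs_of_pos (h0.trans_le hp.1)]
    exact mul_le_mul (pow_le_pow_left₀ (abs_nonneg _) hr K) hp.2 (h0.le.trans hp.1)
      (pow_nonneg ((abs_nonneg _).trans hr) K)
  · have hsnd : Tendsto (fun n : ℝ × ℝ => n.2) (nhds ((0 : ℝ), (0 : ℝ))) (nhds 0) :=
      continuous_snd.tendsto ((0 : ℝ), (0 : ℝ))
    have hfst : Tendsto (fun n : ℝ × ℝ => n.1) (nhds ((0 : ℝ), (0 : ℝ))) (nhds 0) :=
      continuous_fst.tendsto ((0 : ℝ), (0 : ℝ))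
    have hnum := (tendsto_integral_mul_rpow_zero (μ := κ x) (hgx x) (hzx x) (hgB x) hM
      (hzM x)).comp hsnd
    have hden : Tendsto (fun n : ℝ × ℝ => ∫ y, z x y ^ n.2 ∂κ x)
        (nhds ((0 : ℝ), (0 : ℝ))) (nhds 1) := by
      simpa [Function.comp_def] using (tendsto_integral_mul_rpow_zero (μ := κ x) (g := fun _ => 1)
        measurable_const (hzx x) (B := 1) (by simp) hM (hzM x)).comp hsnd
    simpa using ((hnum.div hden one_ne_zero).pow K).mul (hden.rpow hfst (Or.inl one_ne_zero))

/-- under the additional assumption `0 < c ≤ Z ≤ C < ∞`, the analytic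
continuation in `(n1, n2)` of the replicated-system correlation among `K` replicas with
pairwise distinct first replica indices,
`F(n1,n2) = E_D[ (E_{D*|D}[⟨ψ⟩ Z^{n2}] / E_{D*|D}[Z^{n2}])^K (E_{D*|D}[Z^{n2}])^{n1} ]`,
converges to `E_D[ (E_{D*|D}[⟨ψ⟩])^K ]` as `(n1, n2) → (0, 0)`. -/
theorem replicated_correlation_limit_distinct_first_index
    {ΩD Ωs : Type*} [MeasurableSpace ΩD] [MeasurableSpace Ωs]
    (μD : Measure ΩD) [IsProbabilityMeasure μD]
    (κ : Kernel ΩD Ωs) [IsMarkovKernel κ]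
    (d : ℕ) (β : ℝ) (hβ : 0 < β)
    (L : (Fin d → ℝ) → ΩD → Ωs → ℝ)
    (hL : Measurable fun p : (Fin d → ℝ) × ΩD × Ωs => L p.1 p.2.1 p.2.2)
    -- the partition function `Z(D, D*) = ∫ exp(-β L(θ; D, D*)) dθ`
    (Z : ΩD → Ωs → ℝ)
    (hZ : ∀ D Ds, Z D Ds = ∫ θ : Fin d → ℝ, Real.exp (-β * L θ D Ds))
    (hZint : ∀ D Ds, Integrable (fun θ : Fin d → ℝ => Real.exp (-β * L θ D Ds)))
    -- uniform two-sided bounds on the partition function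
    (c C : ℝ) (hc : 0 < c) (hcC : c ≤ C)
    (hZlb : ∀ D Ds, c ≤ Z D Ds) (hZub : ∀ D Ds, Z D Ds ≤ C)
    -- a bounded measurable observable `ψ`
    (ψ : (Fin d → ℝ) → ℝ) (hψm : Measurable ψ)
    (Cψ : ℝ) (hψb : ∀ θ, |ψ θ| ≤ Cψ)
    -- the Gibbs average `⟨ψ⟩(D, D*)`
    (gibbs : ΩD → Ωs → ℝ)
    (hgibbs : ∀ D Ds,
      gibbs D Ds = (∫ θ : Fin d → ℝ, ψ θ * Real.exp (-β * L θ D Ds)) / Z D Ds)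
    (K : ℕ) (hK : 0 < K) :
    Tendsto
      (fun n : ℝ × ℝ =>
        ∫ D,
          ((∫ Ds, gibbs D Ds * (Z D Ds) ^ n.2 ∂(κ D)) /
              (∫ Ds, (Z D Ds) ^ n.2 ∂(κ D))) ^ K *
            (∫ Ds, (Z D Ds) ^ n.2 ∂(κ D)) ^ n.1 ∂μD)
      (nhds ((0 : ℝ), (0 : ℝ)))
      (nhds (∫ D, (∫ Ds, gibbs D Ds ∂(κ D)) ^ K ∂μD)) := by
  have hZm : Measurable (Function.uncurry Z) := by
    have h : StronglyMeasurable fun p : ΩD × Ωs =>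
        ∫ θ : Fin d → ℝ, Real.exp (-β * L θ p.1 p.2) :=
      (Real.measurable_exp.comp (hL.const_mul (-β))).stronglyMeasurable.integral_prod_left'
    convert h.measurable using 2 with p
    exact hZ p.1 p.2
  have hgm : Measurable (Function.uncurry gibbs) := by
    have h : StronglyMeasurable fun p : ΩD × Ωs =>
        ∫ θ : Fin d → ℝ, ψ θ * Real.exp (-β * L θ p.1 p.2) :=
      ((hψm.comp measurable_fst).mul
        (Real.measurable_exp.comp (hL.const_mul (-β)))).stronglyMeasurable.integral_prod_left'
    have heq : Function.uncurry gibbs = fun p : ΩD × Ωs =>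
        (∫ θ : Fin d → ℝ, ψ θ * Real.exp (-β * L θ p.1 p.2)) / Z p.1 p.2 :=
      funext fun p => hgibbs p.1 p.2
    rw [heq]
    exact h.measurable.div hZm
  have hgB (D : ΩD) (Ds : Ωs) : |gibbs D Ds| ≤ Cψ := by
    have hpos : 0 < Z D Ds := hc.trans_le (hZlb D Ds)
    rw [hgibbs, abs_div, abs_of_pos hpos, div_le_iff₀ hpos, hZ, ← integral_const_mul,
      ← Real.norm_eq_abs]
    refine norm_integral_le_of_norm_le ((hZint D Ds).const_mul Cψ) (ae_of_all _ fun θ => ?_)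
    rw [Real.norm_eq_abs, abs_mul, Real.abs_exp]
    exact mul_le_mul_of_nonneg_right (hψb θ) (Real.exp_pos _).le
  have hM : 1 ≤ max C c⁻¹ := by
    rcases le_total 1 c with h | h
    · exact (h.trans hcC).trans (le_max_left _ _)
    · exact ((one_le_inv₀ hc).2 h).trans (le_max_right _ _)
  exact tendsto_integral_tilted_average_pow_mul_rpow μD κ hgm hZm hgB hM
    (fun D Ds => ⟨(inv_le_of_inv_le₀ hc (le_max_right _ _)).trans (hZlb D Ds),
      (hZub D Ds).trans (le_max_left _ _)⟩) K
end

section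
/- Assume additionally that there exist constants 0 < c ≤ C < ∞ with c ≤ Z(D,D*) ≤ C for all (D,D*), and let ψ be bounded measurable and K a positive integer. For real n1, n2 define G(n1, n2) = E_D[ ( E_{D*|D}[ ⟨ψ⟩^K · Z^{n2} ] / E_{D*|D}[ Z^{n2} ] ) · ( E_{D*|D}[ Z^{n2} ] )^{n1} ]. Then G(n1, n2) → E_D[ E_{D*|D}[ ⟨ψ⟩^K ] ] as (n1, n2) → (0, 0). In other words, the analytic continuation to n1, n2 → 0 of the replicated-system correlation among K replicas sharing the same first replica index and having distinct second replica indices encodes the joint average E_{D,D*}[ ⟨ψ⟩^K ]. -/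
open MeasureTheory ProbabilityTheory Filter

/-- Powers with exponent in `[-1, 1]` preserve the interval `[exp (-A), exp A]`. -/
theorem rpow_mem_Icc_exp {A x t : ℝ} (hx : x ∈ Set.Icc (Real.exp (-A)) (Real.exp A))
    (ht : |t| ≤ 1) : x ^ t ∈ Set.Icc (Real.exp (-A)) (Real.exp A) := by
  have hx0 : 0 < x := (Real.exp_pos _).trans_le hx.1
  have hlog : |Real.log x| ≤ A :=
    abs_le.2 ⟨(Real.le_log_iff_exp_le hx0).2 hx.1, (Real.log_le_iff_le_exp hx0).2 hx.2⟩
  have hmul : |Real.log x * t| ≤ A := by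
    rw [abs_mul]
    exact (mul_le_of_le_one_right (abs_nonneg _) ht).trans hlog
  rw [Real.rpow_def_of_pos hx0]
  exact ⟨Real.exp_le_exp.2 (abs_le.1 hmul).1, Real.exp_le_exp.2 (abs_le.1 hmul).2⟩

/-- The mean of a function with values in `[a, b]` lies in `[a, b]`. -/
theorem integral_mem_Icc {α : Type*} [MeasurableSpace α] {μ : Measure α}
    [IsProbabilityMeasure μ] {f : α → ℝ} {a b : ℝ} (hf : Measurable f)
    (hab : ∀ x, f x ∈ Set.Icc a b) : ∫ x, f x ∂μ ∈ Set.Icc a b :=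
  (convex_Icc a b).integral_mem isClosed_Icc (Eventually.of_forall hab)
    (Integrable.of_mem_Icc a b hf.aemeasurable (Eventually.of_forall hab))

theorem eventually_abs_le_one_nhds_zero : ∀ᶠ t : ℝ in nhds 0, |t| ≤ 1 := by
  filter_upwards [Metric.closedBall_mem_nhds (0 : ℝ) one_pos] with t ht
  simpa using ht

/-- Weighting a bounded function by `Z ^ t` does not change its mean in the limit `t → 0`. -/
theorem tendsto_integral_mul_rpow {α : Type*} [MeasurableSpace α] {μ : Measure α}
    [IsProbabilityMeasure μ] {f Z : α → ℝ} {A M : ℝ} (hf : Measurable f) (hZ : Measurable Z)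
    (hfM : ∀ x, |f x| ≤ M) (hZA : ∀ x, Z x ∈ Set.Icc (Real.exp (-A)) (Real.exp A)) :
    Tendsto (fun t : ℝ => ∫ x, f x * Z x ^ t ∂μ) (nhds 0) (nhds (∫ x, f x ∂μ)) := by
  refine tendsto_integral_filter_of_dominated_convergence (fun _ => M * Real.exp A)
    (Eventually.of_forall fun t => (hf.mul (hZ.pow_const t)).aestronglyMeasurable) ?_
    (integrable_const _) (Eventually.of_forall fun x => ?_)
  · filter_upwards [eventually_abs_le_one_nhds_zero] with t ht
    refine Eventually.of_forall fun x => ?_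
    have h := rpow_mem_Icc_exp (hZA x) ht
    rw [Real.norm_eq_abs, abs_mul, abs_of_nonneg ((Real.exp_pos _).le.trans h.1)]
    exact mul_le_mul (hfM x) h.2 ((Real.exp_pos _).le.trans h.1) ((abs_nonneg _).trans (hfM x))
  · have hx0 : Z x ≠ 0 := ((Real.exp_pos _).trans_le (hZA x).1).ne'
    have h : Tendsto (fun t : ℝ => Z x ^ t) (nhds 0) (nhds (Z x ^ (0 : ℝ))) :=
      (Real.continuousAt_const_rpow hx0).tendsto
    simpa using h.const_mul (f x)

/-- The two-exponent replica limit for a bounded measurable observable `f` and a weight `Z`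
bounded away from zero and infinity. -/
theorem tendsto_integral_replica_ratio {α γ : Type*} [MeasurableSpace α] [MeasurableSpace γ]
    {μ : Measure α} [IsProbabilityMeasure μ] {κ : Kernel α γ} [IsMarkovKernel κ]
    {f Z : α → γ → ℝ} {A M : ℝ} (hf : Measurable (Function.uncurry f))
    (hZ : Measurable (Function.uncurry Z)) (hfM : ∀ x y, |f x y| ≤ M)
    (hZA : ∀ x y, Z x y ∈ Set.Icc (Real.exp (-A)) (Real.exp A)) :
    Tendsto
      (fun n : ℝ × ℝ => ∫ x, ((∫ y, f x y * Z x y ^ n.2 ∂(κ x)) / (∫ y, Z x y ^ n.2 ∂(κ x))) *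
        (∫ y, Z x y ^ n.2 ∂(κ x)) ^ n.1 ∂μ)
      (nhds ((0 : ℝ), (0 : ℝ))) (nhds (∫ x, ∫ y, f x y ∂(κ x) ∂μ)) := by
  have hfst : Tendsto (fun n : ℝ × ℝ => n.1) (nhds ((0 : ℝ), (0 : ℝ))) (nhds 0) :=
    continuous_fst.tendsto _
  have hsnd : Tendsto (fun n : ℝ × ℝ => n.2) (nhds ((0 : ℝ), (0 : ℝ))) (nhds 0) :=
    continuous_snd.tendsto _
  have hfx : ∀ x, Measurable (f x) := fun x => hf.comp measurable_prodMk_left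
  have hZx : ∀ x, Measurable (Z x) := fun x => hZ.comp measurable_prodMk_left
  refine tendsto_integral_filter_of_dominated_convergence
    (fun _ => M * Real.exp A / Real.exp (-A) * Real.exp A)
    (Eventually.of_forall fun n => ?_) ?_ (integrable_const _)
    (Eventually.of_forall fun x => ?_)
  · have hden : Measurable fun x => ∫ y, Z x y ^ n.2 ∂(κ x) :=
      (StronglyMeasurable.integral_kernel_prod_right (κ := κ) (f := fun x y => Z x y ^ n.2)
        (hZ.pow_const n.2).stronglyMeasurable).measurable
    have hnum : Measurable fun x => ∫ y, f x y * Z x y ^ n.2 ∂(κ x) :=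
      (StronglyMeasurable.integral_kernel_prod_right (κ := κ)
        (f := fun x y => f x y * Z x y ^ n.2)
        (hf.mul (hZ.pow_const n.2)).stronglyMeasurable).measurable
    exact ((hnum.div hden).mul (hden.pow_const n.1)).aestronglyMeasurable
  · filter_upwards [hfst.eventually eventually_abs_le_one_nhds_zero,
      hsnd.eventually eventually_abs_le_one_nhds_zero] with n h₁ h₂
    refine Eventually.of_forall fun x => ?_
    have hpow := fun y => rpow_mem_Icc_exp (hZA x y) h₂
    have hden := integral_mem_Icc (μ := κ x) ((hZx x).pow_const n.2) hpow
    have hout := rpow_mem_Icc_exp hden h₁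
    have hden0 := (Real.exp_pos _).trans_le hden.1
    have hout0 := (Real.exp_pos _).trans_le hout.1
    have hnum : |∫ y, f x y * Z x y ^ n.2 ∂(κ x)| ≤ M * Real.exp A := by
      have h := norm_integral_le_of_norm_le_const (μ := κ x)
        (f := fun y => f x y * Z x y ^ n.2) (C := M * Real.exp A)
        (Eventually.of_forall fun y => by
          have h0 := (Real.exp_pos _).le.trans (hpow y).1
          rw [Real.norm_eq_abs, abs_mul, abs_of_nonneg h0]
          exact mul_le_mul (hfM x y) (hpow y).2 h0 ((abs_nonneg _).trans (hfM x y)))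
      simpa using h
    have hnum0 := (abs_nonneg _).trans hnum
    rw [Real.norm_eq_abs, abs_mul, abs_div, abs_of_pos hden0, abs_of_pos hout0]
    exact mul_le_mul (div_le_div₀ hnum0 hnum (Real.exp_pos _) hden.1) hout.2 hout0.le
      (div_nonneg hnum0 (Real.exp_pos _).le)
  · have hnum := (tendsto_integral_mul_rpow (μ := κ x) (hfx x) (hZx x) (hfM x) (hZA x)).comp hsnd
    have hden : Tendsto (fun n : ℝ × ℝ => ∫ y, Z x y ^ n.2 ∂(κ x))
        (nhds ((0 : ℝ), (0 : ℝ))) (nhds 1) := by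
      have h := (tendsto_integral_mul_rpow (μ := κ x) (f := fun _ => 1) (M := 1)
        measurable_const (hZx x) (by simp) (hZA x)).comp hsnd
      simpa [Function.comp_def] using h
    simpa [Function.comp_def] using
      (hnum.div hden one_ne_zero).mul (hden.rpow hfst (Or.inl one_ne_zero))

/-- under the additional assumption `0 < c ≤ Z ≤ C < ∞`, the analytic
continuation in `(n1, n2)` of the replicated-system correlation among `K` replicas sharing
the same first replica index and having distinct second replica indices,
`G(n1,n2) = E_D[ (E_{D*|D}[⟨ψ⟩^K Z^{n2}] / E_{D*|D}[Z^{n2}]) (E_{D*|D}[Z^{n2}])^{n1} ]`,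
converges to the joint average `E_D[ E_{D*|D}[⟨ψ⟩^K] ]` as `(n1, n2) → (0, 0)`. -/
theorem replicated_correlation_limit_same_first_index
    {ΩD Ωs : Type*} [MeasurableSpace ΩD] [MeasurableSpace Ωs]
    (μD : Measure ΩD) [IsProbabilityMeasure μD]
    (κ : Kernel ΩD Ωs) [IsMarkovKernel κ]
    (d : ℕ) (β : ℝ) (hβ : 0 < β)
    (L : (Fin d → ℝ) → ΩD → Ωs → ℝ)
    (hL : Measurable fun p : (Fin d → ℝ) × ΩD × Ωs => L p.1 p.2.1 p.2.2)
    -- the partition function `Z(D, D*) = ∫ exp(-β L(θ; D, D*)) dθ`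
    (Z : ΩD → Ωs → ℝ)
    (hZ : ∀ D Ds, Z D Ds = ∫ θ : Fin d → ℝ, Real.exp (-β * L θ D Ds))
    (hZint : ∀ D Ds, Integrable (fun θ : Fin d → ℝ => Real.exp (-β * L θ D Ds)))
    -- uniform two-sided bounds on the partition function
    (c C : ℝ) (hc : 0 < c) (hcC : c ≤ C)
    (hZlb : ∀ D Ds, c ≤ Z D Ds) (hZub : ∀ D Ds, Z D Ds ≤ C)
    -- a bounded measurable observable `ψ`
    (ψ : (Fin d → ℝ) → ℝ) (hψm : Measurable ψ)
    (Cψ : ℝ) (hψb : ∀ θ, |ψ θ| ≤ Cψ)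
    -- the Gibbs average `⟨ψ⟩(D, D*)`
    (gibbs : ΩD → Ωs → ℝ)
    (hgibbs : ∀ D Ds,
      gibbs D Ds = (∫ θ : Fin d → ℝ, ψ θ * Real.exp (-β * L θ D Ds)) / Z D Ds)
    (K : ℕ) (hK : 0 < K) :
    Tendsto
      (fun n : ℝ × ℝ =>
        ∫ D,
          ((∫ Ds, (gibbs D Ds) ^ K * (Z D Ds) ^ n.2 ∂(κ D)) /
              (∫ Ds, (Z D Ds) ^ n.2 ∂(κ D))) *
            (∫ Ds, (Z D Ds) ^ n.2 ∂(κ D)) ^ n.1 ∂μD)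
      (nhds ((0 : ℝ), (0 : ℝ)))
      (nhds (∫ D, (∫ Ds, (gibbs D Ds) ^ K ∂(κ D)) ∂μD)) := by
  have hw : Measurable fun p : (Fin d → ℝ) × ΩD × Ωs => Real.exp (-β * L p.1 p.2.1 p.2.2) :=
    (hL.const_mul (-β)).exp
  have hZm : Measurable (Function.uncurry Z) := by
    have h := (StronglyMeasurable.integral_prod_left' (μ := (volume : Measure (Fin d → ℝ)))
      hw.stronglyMeasurable).measurable
    exact (funext fun p => hZ p.1 p.2 : Function.uncurry Z = _) ▸ h
  have hgm : Measurable (Function.uncurry gibbs) := by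
    have h := (StronglyMeasurable.integral_prod_left' (μ := (volume : Measure (Fin d → ℝ)))
      ((hψm.comp measurable_fst).mul hw).stronglyMeasurable).measurable
    exact (funext fun p => hgibbs p.1 p.2 : Function.uncurry gibbs = _) ▸ h.div hZm
  have hgb : ∀ D Ds, |gibbs D Ds| ≤ Cψ := fun D Ds => by
    have hZ0 := hc.trans_le (hZlb D Ds)
    rw [hgibbs, abs_div, abs_of_pos hZ0, div_le_iff₀ hZ0, hZ, ← integral_const_mul,
      ← Real.norm_eq_abs]
    refine norm_integral_le_of_norm_le ((hZint D Ds).const_mul Cψ)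
      (Eventually.of_forall fun θ => ?_)
    rw [Real.norm_eq_abs, abs_mul, Real.abs_exp]
    exact mul_le_mul_of_nonneg_right (hψb θ) (Real.exp_pos _).le
  have hZA : ∀ D Ds, Z D Ds ∈ Set.Icc (Real.exp (-max (-Real.log c) (Real.log C)))
      (Real.exp (max (-Real.log c) (Real.log C))) := fun D Ds => by
    constructor
    · refine le_trans ?_ (hZlb D Ds)
      rw [← Real.le_log_iff_exp_le hc]
      exact neg_le.1 (le_max_left _ _)
    · refine (hZub D Ds).trans ?_
      rw [← Real.log_le_iff_le_exp (hc.trans_le hcC)]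
      exact le_max_right _ _
  refine tendsto_integral_replica_ratio (f := fun D Ds => gibbs D Ds ^ K) (M := Cψ ^ K)
    (hgm.pow_const K) hZm (fun D Ds => ?_) hZA
  rw [abs_pow]
  exact pow_le_pow_left₀ (abs_nonneg _) (hgb D Ds) K
end
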